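/- For every linear order C in which < is well-founded, the order composition of a 2-element antichain followed by C (a '(1,1)-based chain') is an ali order. -/

import Mathlib

universe u

/-- The level of an element `x` of a partial order with well-founded `<`:
`Level(x) = sup { Level(y) + 1 : y < x }`, i.e. the rank of `x` with respect to `<`. -/
noncomputable def level (α : Type u) [PartialOrder α] [WellFoundedLT α] (x : α) : Ordinal.{u} :=
  IsWellFounded.rank (α := α) (· < ·) x

/-- Two elements of a partial order are incomparable. -/
def Incomp {α : Type u} [Preorder α] (a b : α) : Prop := ¬ a ≤ b ∧ ¬ b ≤ a

/-- An order embedding `f : α ↪o β` is level-induced when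
`Level(x) = Level(y) ↔ Level(f x) = Level(f y)` for all `x y`. -/
def LevelInduced {α β : Type u} [PartialOrder α] [WellFoundedLT α]
    [PartialOrder β] [WellFoundedLT β] (f : α ↪o β) : Prop :=
  ∀ x y : α, level α x = level α y ↔ level β (f x) = level β (f y)

/-- The gap between two elements: `max(Level x, Level y) - min(Level x, Level y)`
(ordinal subtraction). -/
noncomputable def gap (α : Type u) [PartialOrder α] [WellFoundedLT α] (x y : α) : Ordinal.{u} :=
  max (level α x) (level α y) - min (level α x) (level α y)

/-- An order embedding `f : α ↪o β` is consecutive level-induced when it preserves gaps. -/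
def ConsecutiveLevelInduced {α β : Type u} [PartialOrder α] [WellFoundedLT α]
    [PartialOrder β] [WellFoundedLT β] (f : α ↪o β) : Prop :=
  ∀ x y : α, gap α x y = gap β (f x) (f y)

/-- `α` is an ali order: whenever `α` order-embeds into a partial order `β` with
well-founded `<`, there is a level-induced order embedding of `α` into `β`. -/
def AliOrder (α : Type u) [PartialOrder α] [WellFoundedLT α] : Prop :=
  ∀ (β : Type u) [PartialOrder β] [WellFoundedLT β],
    Nonempty (α ↪o β) → ∃ f : α ↪o β, LevelInduced f

/-- `α` is a nacli order: whenever there is a level-induced order embedding of `α` into a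
partial order `β` with well-founded `<`, there is a consecutive level-induced order
embedding of `α` into `β`. -/
def NacliOrder (α : Type u) [PartialOrder α] [WellFoundedLT α] : Prop :=
  ∀ (β : Type u) [PartialOrder β] [WellFoundedLT β],
    (∃ f : α ↪o β, LevelInduced f) → ∃ g : α ↪o β, ConsecutiveLevelInduced g

theorem level_lt {α : Type u} [PartialOrder α] [WellFoundedLT α] {x y : α} (h : x < y) :
    level α x < level α y := IsWellFounded.rank_lt_of_rel (r := (· < ·)) h

theorem exists_below {α : Type u} [PartialOrder α] [WellFoundedLT α] (v : α) :
    ∀ o < level α v, ∃ y < v, level α y = o := by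
  induction v using WellFoundedLT.induction with
  | ind v ih =>
    intro o ho
    by_contra hcon
    push Not at hcon
    apply absurd ho
    rw [not_lt]
    unfold level
    rw [IsWellFounded.rank_eq]
    apply Ordinal.iSup_le
    rintro ⟨y, hy⟩
    by_contra hlt
    have h1 : o ≤ level α y := by
      by_contra h2
      exact hlt (Order.succ_le_of_lt (not_le.1 h2))
    rcases h1.lt_or_eq with h2 | h2
    · obtain ⟨z, hz, hzo⟩ := ih y hy o h2
      exact hcon z (hz.trans hy) hzo
    · exact hcon y hy h2.symm

theorem core_build (P : Type u) [PartialOrder P] [WellFoundedLT P]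
    (a b : P) (hab : a ≠ b) (hinc : Incomp a b)
    (hbelow : ∀ x : P, x ≠ a → x ≠ b → a < x ∧ b < x)
    (hchain : IsChain (· ≤ ·) {x : P | x ≠ a ∧ x ≠ b})
    (β : Type u) [PartialOrder β] [WellFoundedLT β] (f : P ↪o β) (p q : β)
    (hpq : p ≠ q) (hl : level β p = level β q)
    (hp : ∀ x, x ≠ a → x ≠ b → p < f x ∧ q < f x) :
    ∃ f : P ↪o β, LevelInduced f := by
  classical
  have hina : ∀ z, ¬ z < a := by
    intro z hz
    by_cases h : z = b
    · subst h; exact hinc.2 hz.le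
    · exact lt_asymm hz (hbelow z hz.ne h).1
  have hinb : ∀ z, ¬ z < b := by
    intro z hz
    by_cases h : z = a
    · subst h; exact hinc.1 hz.le
    · exact lt_asymm hz (hbelow z h hz.ne).2
  have hlP : level P a = level P b := by
    apply le_antisymm
    · by_contra h
      obtain ⟨y, hy, _⟩ := exists_below a _ (not_le.1 h)
      exact hina y hy
    · by_contra h
      obtain ⟨y, hy, _⟩ := exists_below b _ (not_le.1 h)
      exact hinb y hy
  let g : P → β := fun x => if x = a then p else if x = b then q else f x
  have ga : g a = p := by simp [g]
  have gb : g b = q := by simp [g, hab.symm]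
  have gx : ∀ x, x ≠ a → x ≠ b → g x = f x := by
    intro x h1 h2; simp [g, h1, h2]
  have hmono : ∀ x y, x < y → g x < g y := by
    intro x y h
    have hya : y ≠ a := by rintro rfl; exact hina _ h
    have hyb : y ≠ b := by rintro rfl; exact hinb _ h
    rw [gx y hya hyb]
    by_cases hxa : x = a
    · rw [hxa, ga]; exact (hp y hya hyb).1
    by_cases hxb : x = b
    · rw [hxb, gb]; exact (hp y hya hyb).2
    rw [gx x hxa hxb]; exact f.lt_iff_lt.2 h
  have hpq1 : ¬ p ≤ q := fun h => (level_lt (lt_of_le_of_ne h hpq)).ne hl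
  have hpq2 : ¬ q ≤ p := fun h => (level_lt (lt_of_le_of_ne h hpq.symm)).ne hl.symm
  have hcases : ∀ x y : P, x = y ∨ x < y ∨ y < x ∨ (x = a ∧ y = b) ∨ (x = b ∧ y = a) := by
    intro x y
    by_cases hxy : x = y
    · exact Or.inl hxy
    by_cases hx : x ≠ a ∧ x ≠ b
    · by_cases hy : y ≠ a ∧ y ≠ b
      · rcases hchain hx hy hxy with h | h
        · exact Or.inr (Or.inl (lt_of_le_of_ne h hxy))
        · exact Or.inr (Or.inr (Or.inl (lt_of_le_of_ne h (Ne.symm hxy))))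
      · have := hbelow x hx.1 hx.2
        grind
    · by_cases hy : y ≠ a ∧ y ≠ b
      · have := hbelow y hy.1 hy.2
        grind
      · grind
  refine ⟨OrderEmbedding.ofMapLEIff g ?_, ?_⟩
  · intro x y
    rcases hcases x y with h | h | h | ⟨h, h'⟩ | ⟨h, h'⟩
    · simp [h]
    · exact iff_of_true (hmono _ _ h).le h.le
    · exact iff_of_false (hmono _ _ h).not_ge h.not_ge
    · rw [h, h', ga, gb]; exact iff_of_false hpq1 hinc.1
    · rw [h, h', ga, gb]; exact iff_of_false hpq2 hinc.2
  · intro x y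
    change _ ↔ level β (g x) = level β (g y)
    rcases hcases x y with h | h | h | ⟨h, h'⟩ | ⟨h, h'⟩
    · simp [h]
    · exact iff_of_false (level_lt h).ne (level_lt (hmono _ _ h)).ne
    · exact iff_of_false (level_lt h).ne' (level_lt (hmono _ _ h)).ne'
    · rw [h, h', ga, gb]; exact iff_of_true hlP hl
    · rw [h, h', ga, gb]; exact iff_of_true hlP.symm hl.symm

/-- The order composition of a 2-element antichain followed by a well-founded chain
(a "(1,1)-based chain") is an ali order. -/
theorem stmt12 (P : Type u) [PartialOrder P] [WellFoundedLT P]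
    (a b : P) (hab : a ≠ b) (hinc : Incomp a b)
    (hbelow : ∀ x : P, x ≠ a → x ≠ b → a < x ∧ b < x)
    (hchain : IsChain (· ≤ ·) {x : P | x ≠ a ∧ x ≠ b}) :
    AliOrder P := by
  intro β _ _ ⟨f⟩
  have key := core_build P a b hab hinc hbelow hchain β f
  rcases lt_trichotomy (level β (f a)) (level β (f b)) with h | h | h
  · obtain ⟨y, hy, hyl⟩ := exists_below (f b) _ h
    refine key (f a) y ?_ hyl.symm ?_
    · intro e
      exact hinc.1 (f.le_iff_le.1 (e ▸ hy.le))
    · intro x hxa hxb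
      have := hbelow x hxa hxb
      exact ⟨f.lt_iff_lt.2 this.1, hy.trans (f.lt_iff_lt.2 this.2)⟩
  · refine key (f a) (f b) (fun e => hab (f.injective e)) h ?_
    intro x hxa hxb
    have := hbelow x hxa hxb
    exact ⟨f.lt_iff_lt.2 this.1, f.lt_iff_lt.2 this.2⟩
  · obtain ⟨y, hy, hyl⟩ := exists_below (f a) _ h
    refine key y (f b) ?_ hyl ?_
    · intro e
      exact hinc.2 (f.le_iff_le.1 (e ▸ hy.le))
    · intro x hxa hxb
      have := hbelow x hxa hxb
      exact ⟨hy.trans (f.lt_iff_lt.2 this.1), f.lt_iff_lt.2 this.2⟩
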